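/- For every n ≥ 2 and every vertex v of the cycle graph C_{2n} on 2n vertices, there do not exist two level-disjoint partitions of C_{2n} rooted at v. -/

import Mathlib

open SimpleGraph

variable {V : Type*}

/-- `L = (S_0, …, S_h)` is a level partition of the vertex set `U` with respect to the
adjacency relation `Adj`: the levels are nonempty, pairwise disjoint, their union is `U`,
and every vertex of a level `S_i` (`i ≥ 1`) has a neighbor in the previous level `S_{i-1}`. -/
def IsLevelPartitionOn (Adj : V → V → Prop) (U : Set V) (L : List (Finset V)) : Prop :=
  L ≠ [] ∧
  (∀ i, i < L.length → (L.getD i ∅).Nonempty) ∧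
  (∀ i j, i < L.length → j < L.length → i ≠ j → Disjoint (L.getD i ∅) (L.getD j ∅)) ∧
  (∀ x : V, x ∈ U ↔ ∃ i < L.length, x ∈ L.getD i ∅) ∧
  (∀ i, 1 ≤ i → i < L.length → ∀ u ∈ L.getD i ∅, ∃ w ∈ L.getD (i - 1) ∅, Adj u w)

/-- A level partition of the graph `G` (on its whole vertex set). -/
def IsLevelPartition (G : SimpleGraph V) (L : List (Finset V)) : Prop :=
  IsLevelPartitionOn G.Adj Set.univ L

/-- A level partition is rooted at `v` if its level `0` is the singleton `{v}`. -/
def RootedAt (v : V) (L : List (Finset V)) : Prop :=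
  L.getD 0 ∅ = {v}

/-- Two level partitions are level-disjoint if their levels `i` are disjoint
for every `1 ≤ i ≤ min(h, h')`. -/
def LevelDisjoint (L M : List (Finset V)) : Prop :=
  ∀ i, 1 ≤ i → i < L.length → i < M.length → Disjoint (L.getD i ∅) (M.getD i ∅)

/-- In a level partition rooted at `v` of a graph whose edges join elements of an additive group
differing by `d`, the elements of level `i` are reached from `v` by `i` steps in one direction,
and the intermediate elements lie in the intermediate levels. -/
theorem IsLevelPartition.exists_direction {A : Type*} [AddCommGroup A] {G : SimpleGraph A}
    {d : A} (hG : ∀ u w, G.Adj u w → u = w + d ∨ u = w - d) {v : A} {L : List (Finset A)}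
    (hL : IsLevelPartition G L) (hv : RootedAt v L) (i : ℕ) (hi : i < L.length) (u : A)
    (hu : u ∈ L.getD i ∅) :
    ∃ e, (e = d ∨ e = -d) ∧ u = v + i • e ∧ ∀ j ≤ i, v + j • e ∈ L.getD j ∅ := by
  obtain ⟨-, -, hdisj, -, hadj⟩ := hL
  induction i generalizing u with
  | zero =>
    have huv : u = v := by rw [hv] at hu; simpa using hu
    subst huv
    refine ⟨d, .inl rfl, by simp, fun j hj ↦ ?_⟩
    obtain rfl : j = 0 := by omega
    simpa using hu
  | succ i ih =>
    obtain ⟨w, hw, huw⟩ := hadj (i + 1) (by omega) hi u hu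
    obtain ⟨e, he, rfl, hpath⟩ := ih (by omega) w hw
    have extend : ∀ e', (e' = d ∨ e' = -d) → u = v + (i + 1) • e' →
        (∀ j ≤ i, v + j • e' ∈ L.getD j ∅) →
        ∃ e, (e = d ∨ e = -d) ∧ u = v + (i + 1) • e ∧
          ∀ j ≤ i + 1, v + j • e ∈ L.getD j ∅ := by
      refine fun e' he' hue' hpath' ↦ ⟨e', he', hue', fun j hj ↦ ?_⟩
      rcases Nat.lt_or_eq_of_le hj with hj | rfl
      · exact hpath' j (by omega)
      · exact hue' ▸ hu
    have hstep : u = v + i • e + e ∨ u = v + i • e - e := by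
      rcases he with rfl | rfl
      · exact hG _ _ huw
      · rcases hG _ _ huw with h | h
        · right; rw [h]; abel
        · left; rw [h]; abel
    rcases hstep with h | h
    · exact extend e he (by rw [h, succ_nsmul]; abel) hpath
    · rcases i with _ | i
      · refine extend (-e) ?_ (by rw [h]; simp [sub_eq_add_neg]) fun j hj ↦ ?_
        · rcases he with rfl | rfl <;> simp
        · obtain rfl : j = 0 := by omega
          simpa using hpath 0 le_rfl
      · have hback : u ∈ L.getD i ∅ := by
          have hui : u = v + i • e := by rw [h, succ_nsmul]; abel
          exact hui ▸ hpath i (by omega)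
        exact absurd hu (Finset.disjoint_left.1
          (hdisj i (i + 1 + 1) (by omega) hi (by omega)) hback)

/-- If the step `d` has order `2 * n`, then the element antipodal to the root lies in level `n`. -/
theorem IsLevelPartition.antipode_mem {A : Type*} [AddCommGroup A] {G : SimpleGraph A}
    {d : A} (hG : ∀ u w, G.Adj u w → u = w + d ∨ u = w - d) {n : ℕ} (hn : 0 < n)
    (hd : addOrderOf d = 2 * n) {v : A} {L : List (Finset A)}
    (hL : IsLevelPartition G L) (hv : RootedAt v L) :
    n < L.length ∧ v + n • d ∈ L.getD n ∅ := by
  obtain ⟨i, hi, hmem⟩ := (hL.2.2.2.1 (v + n • d)).1 trivial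
  obtain ⟨e, he, heq, hpath⟩ := hL.exists_direction hG hv i hi _ hmem
  have hde : addOrderOf e = 2 * n := by
    rcases he with rfl | rfl
    · exact hd
    · rw [addOrderOf_neg, hd]
  have hne : n • d = n • e := by
    rcases he with rfl | rfl
    · rfl
    · rw [smul_neg, eq_neg_iff_add_eq_zero, ← add_nsmul, ← two_mul, ← hd,
        addOrderOf_nsmul_eq_zero]
  have hlt : i < 2 * n := by
    by_contra! hle
    have hroot := hpath (2 * n) hle
    rw [← hde, addOrderOf_nsmul_eq_zero, hde] at hroot
    refine Finset.disjoint_left.1 (hL.2.2.1 (2 * n) 0 (by omega) (by omega) (by omega)) hroot ?_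
    rw [hv]
    simp
  have hin : i = n := by
    refine nsmul_injOn_Iio_addOrderOf (x := e) ?_ ?_ ?_
    · simpa [hde] using hlt
    · simp only [hde, Set.mem_Iio]; omega
    · exact (add_left_cancel heq).symm.trans hne
  subst hin
  exact ⟨hi, hmem⟩

/-- The edges of a cycle graph join elements differing by one. -/
theorem SimpleGraph.cycleGraph_adj_eq_add_or_sub {m : ℕ} (u w : Fin (m + 2))
    (h : (cycleGraph (m + 2)).Adj u w) : u = w + 1 ∨ u = w - 1 := by
  rcases cycleGraph_adj.1 h with h | h
  · left; rw [← h]; abel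
  · right; rw [← h]; abel

/-- For `n ≥ 2`, the even cycle `C_{2n}` has no two level-disjoint
partitions rooted at the same vertex. -/
theorem even_cycle_no_two_rooted_LDPs (n : ℕ) (hn : 2 ≤ n) (v : Fin (2 * n)) :
    ¬ ∃ S T : List (Finset (Fin (2 * n))),
        IsLevelPartition (SimpleGraph.cycleGraph (2 * n)) S ∧ RootedAt v S ∧
        IsLevelPartition (SimpleGraph.cycleGraph (2 * n)) T ∧ RootedAt v T ∧
        LevelDisjoint S T := by
  rintro ⟨S, T, hS, hvS, hT, hvT, hST⟩
  obtain ⟨m, hm⟩ : ∃ m, 2 * n = m + 2 := ⟨2 * n - 2, by omega⟩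
  have hord : addOrderOf (1 : Fin (m + 2)) = 2 * n :=
    (ZMod.addOrderOf_one (m + 2)).trans hm.symm
  generalize 2 * n = k at v S T hm
  subst hm
  have hadj := SimpleGraph.cycleGraph_adj_eq_add_or_sub (m := m)
  obtain ⟨hnS, hmemS⟩ := hS.antipode_mem hadj (by omega) hord hvS
  obtain ⟨hnT, hmemT⟩ := hT.antipode_mem hadj (by omega) hord hvT
  exact Finset.disjoint_left.1 (hST n (by omega) hnS hnT) hmemS hmemT
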